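/- arXiv:2508.21536 — 7 statements merged into one kernel-verified Lean document; each statement's English description precedes it below -/
import Mathlib

section
/- Let (Ω, F, P) be a probability space and let ε : Ω → ℝ^{N×T} and L̂ : Ω → ℝ^{N×T} be entrywise integrable random matrices with E[ε_{it}] = 0 for every cell (i,t) and with E[L̂] = Γ (I_K + B) Λᵀ entrywise, where Γ ∈ ℝ^{N×K}, Λ ∈ ℝ^{T×K}, B ∈ ℝ^{K×K} and I_K is the K×K identity. Set Y := Γ Λᵀ + ε. Then for fixed weights ω ∈ ℝ^{N₀} and θ ∈ ℝ^{T₀}, E[ τ̂_TROP(0;θ,ω) − Y_{NT} ] = Δ_u(ω,Γ)ᵀ B Δ_t(θ,Λ). -/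
open Finset Matrix MeasureTheory

noncomputable section

/-- The TROP counterfactual `τ̂_TROP(0; θ, ω)` for the treated cell `(N, T)`. -/
def tauTROP {N₀ T₀ : ℕ} (Y Lhat : Matrix (Fin (N₀ + 1)) (Fin (T₀ + 1)) ℝ)
    (θ : Fin T₀ → ℝ) (ω : Fin N₀ → ℝ) : ℝ :=
  Lhat (Fin.last N₀) (Fin.last T₀)
    + ∑ t : Fin T₀, θ t * (Y (Fin.last N₀) t.castSucc - Lhat (Fin.last N₀) t.castSucc)
    + ∑ i : Fin N₀, ω i * (Y i.castSucc (Fin.last T₀) - Lhat i.castSucc (Fin.last T₀))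
    - ∑ i : Fin N₀, ∑ t : Fin T₀,
        ω i * θ t * (Y i.castSucc t.castSucc - Lhat i.castSucc t.castSucc)

/-- Unit discrepancy `Δ_u(ω,Γ) := Σ_{i≤N₀} ω_i Γ_i − Γ_N ∈ ℝ^K`. -/
def unitDisc {N₀ K : ℕ} (ω : Fin N₀ → ℝ) (Γ : Matrix (Fin (N₀ + 1)) (Fin K) ℝ) :
    Fin K → ℝ :=
  fun k => (∑ i : Fin N₀, ω i * Γ i.castSucc k) - Γ (Fin.last N₀) k

/-- Time discrepancy `Δ_t(θ,Λ) := Σ_{s≤T₀} θ_s Λ_s − Λ_T ∈ ℝ^K`. -/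
def timeDisc {T₀ K : ℕ} (θ : Fin T₀ → ℝ) (Λ : Matrix (Fin (T₀ + 1)) (Fin K) ℝ) :
    Fin K → ℝ :=
  fun k => (∑ s : Fin T₀, θ s * Λ s.castSucc k) - Λ (Fin.last T₀) k

/-- The weights `w` on the controls, followed by `-1` on the treated index. -/
def contrast {n : ℕ} (w : Fin n → ℝ) : Fin (n + 1) → ℝ :=
  Fin.snoc w (-1)

lemma unitDisc_eq_contrast_vecMul {N₀ K : ℕ} (ω : Fin N₀ → ℝ)
    (Γ : Matrix (Fin (N₀ + 1)) (Fin K) ℝ) : unitDisc ω Γ = contrast ω ᵥ* Γ := by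
  ext k
  simp [unitDisc, contrast, vecMul, dotProduct, Fin.sum_univ_castSucc, sub_eq_add_neg]

lemma timeDisc_eq_transpose_mulVec_contrast {T₀ K : ℕ} (θ : Fin T₀ → ℝ)
    (Λ : Matrix (Fin (T₀ + 1)) (Fin K) ℝ) : timeDisc θ Λ = Λᵀ *ᵥ contrast θ := by
  ext k
  simp [timeDisc, contrast, mulVec, dotProduct, Fin.sum_univ_castSucc, sub_eq_add_neg, mul_comm]

/-- The error of the TROP counterfactual is a bilinear contrast of the matrix `L̂ - Y`. -/
lemma tauTROP_sub_eq_sum_contrast {N₀ T₀ : ℕ} (Y Lhat : Matrix (Fin (N₀ + 1)) (Fin (T₀ + 1)) ℝ)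
    (θ : Fin T₀ → ℝ) (ω : Fin N₀ → ℝ) :
    tauTROP Y Lhat θ ω - Y (Fin.last N₀) (Fin.last T₀)
      = ∑ i, ∑ t, contrast ω i * contrast θ t * (Lhat i t - Y i t) := by
  simp only [tauTROP, contrast, Fin.sum_univ_castSucc, Fin.snoc_castSucc, Fin.snoc_last,
    Finset.sum_add_distrib, mul_sub, Finset.sum_sub_distrib, mul_neg, neg_mul, mul_one, one_mul,
    Finset.sum_neg_distrib]
  ring

lemma sum_sum_mul_eq_dotProduct_mulVec {m n : Type*} [Fintype m] [Fintype n]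
    (a : m → ℝ) (b : n → ℝ) (M : Matrix m n ℝ) :
    ∑ i, ∑ t, a i * b t * M i t = a ⬝ᵥ M *ᵥ b := by
  simp only [dotProduct, mulVec, Finset.mul_sum]
  exact Finset.sum_congr rfl fun i _ => Finset.sum_congr rfl fun t _ => by ring

/-- under the factor model `Y = Γ Λᵀ + ε` with `E[ε_{it}] = 0` and
`E[L̂] = Γ (I_K + B) Λᵀ`, for fixed weights `ω, θ`,
`E[ τ̂_TROP(0;θ,ω) − Y_{NT} ] = Δ_u(ω,Γ)ᵀ B Δ_t(θ,Λ)`. -/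
theorem tauTROP_bias_factor_model
    {Ω : Type*} [MeasurableSpace Ω] (μ : Measure Ω) [IsProbabilityMeasure μ]
    (N₀ T₀ K : ℕ) (hN : 1 ≤ N₀) (hT : 1 ≤ T₀) (hK : 1 ≤ K)
    (Γ : Matrix (Fin (N₀ + 1)) (Fin K) ℝ) (Λ : Matrix (Fin (T₀ + 1)) (Fin K) ℝ)
    (B : Matrix (Fin K) (Fin K) ℝ)
    (ε Lhat : Ω → Matrix (Fin (N₀ + 1)) (Fin (T₀ + 1)) ℝ)
    (hεint : ∀ i t, Integrable (fun w => ε w i t) μ)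
    (hεmean : ∀ i t, ∫ w, ε w i t ∂μ = 0)
    (hLint : ∀ i t, Integrable (fun w => Lhat w i t) μ)
    (hLmean : ∀ i t, ∫ w, Lhat w i t ∂μ = ((Γ * (1 + B) * Λ.transpose : Matrix (Fin (N₀ + 1)) (Fin (T₀ + 1)) ℝ)) i t)
    (ω : Fin N₀ → ℝ) (θ : Fin T₀ → ℝ) :
    (∫ w, (tauTROP (Γ * Λ.transpose + ε w) (Lhat w) θ ω
        - (Γ * Λ.transpose + ε w) (Fin.last N₀) (Fin.last T₀)) ∂μ)
      = unitDisc ω Γ ⬝ᵥ B.mulVec (timeDisc θ Λ) := by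
  have hcell_int (i : Fin (N₀ + 1)) (t : Fin (T₀ + 1)) :
      Integrable (fun w => Lhat w i t - (Γ * Λᵀ + ε w) i t) μ :=
    (hLint i t).sub ((integrable_const _).add (hεint i t))
  have hcell_mean (i : Fin (N₀ + 1)) (t : Fin (T₀ + 1)) :
      ∫ w, (Lhat w i t - (Γ * Λᵀ + ε w) i t) ∂μ = (Γ * B * Λᵀ) i t := by
    have hY : Integrable (fun w => (Γ * Λᵀ) i t + ε w i t) μ :=
      (integrable_const _).add (hεint i t)
    simp only [Matrix.add_apply]
    rw [integral_sub (hLint i t) hY,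
      integral_add (integrable_const _) (hεint i t), hLmean, hεmean]
    simp [Matrix.mul_add, Matrix.add_mul]
  simp_rw [tauTROP_sub_eq_sum_contrast]
  rw [integral_finsetSum _ fun i _ =>
    integrable_finsetSum _ fun t _ => (hcell_int i t).const_mul _]
  simp_rw [integral_finsetSum Finset.univ fun t _ => (hcell_int _ t).const_mul _,
    integral_const_mul, hcell_mean]
  rw [sum_sum_mul_eq_dotProduct_mulVec, unitDisc_eq_contrast_vecMul,
    timeDisc_eq_transpose_mulVec_contrast, ← dotProduct_mulVec, mulVec_mulVec, mulVec_mulVec,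
    Matrix.mul_assoc]
end
end

section
/- (Triple robustness bound.) Let (Ω, F, P) be a probability space and let ε : Ω → ℝ^{N×T} and L̂ : Ω → ℝ^{N×T} be entrywise integrable random matrices with E[ε_{it}] = 0 for every cell (i,t) and with E[L̂] = Γ (I_K + B) Λᵀ entrywise, where Γ ∈ ℝ^{N×K}, Λ ∈ ℝ^{T×K}, B ∈ ℝ^{K×K} and I_K is the K×K identity. Set Y := Γ Λᵀ + ε. Then for fixed weights ω ∈ ℝ^{N₀} and θ ∈ ℝ^{T₀}, | E[ τ̂_TROP(0;θ,ω) − Y_{NT} ] | ≤ ‖Δ_u(ω,Γ)‖₂ · ‖Δ_t(θ,Λ)‖₂ · ‖B‖, where ‖B‖ is the spectral norm (ℓ²→ℓ² operator norm) of B; i.e., the bias is bounded by the product of the unit imbalance, the time imbalance, and the misspecification of the regression adjustment. -/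
open Finset Matrix MeasureTheory

noncomputable section

/-- Euclidean (`ℓ²`) norm of a vector in `ℝ^n`. -/
def euclNorm {n : ℕ} (v : Fin n → ℝ) : ℝ :=
  ‖(EuclideanSpace.equiv (Fin n) ℝ).symm v‖

/-- The `ℓ² → ℓ²` operator norm (spectral norm) of a real matrix. -/
def specNorm {m n : ℕ} (A : Matrix (Fin m) (Fin n) ℝ) : ℝ :=
  ‖LinearMap.toContinuousLinearMap (Matrix.toEuclideanLin A)‖

theorem tauTROP_sub_eq_dotProduct {N₀ T₀ : ℕ}
    (Y Lhat : Matrix (Fin (N₀ + 1)) (Fin (T₀ + 1)) ℝ) (θ : Fin T₀ → ℝ) (ω : Fin N₀ → ℝ) :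
    tauTROP Y Lhat θ ω - Y (Fin.last N₀) (Fin.last T₀)
      = (Fin.snoc ω (-1) : Fin (N₀ + 1) → ℝ) ⬝ᵥ
          (Lhat - Y) *ᵥ (Fin.snoc θ (-1) : Fin (T₀ + 1) → ℝ) := by
  simp only [tauTROP, dotProduct, mulVec, Fin.sum_univ_castSucc, Fin.snoc_castSucc, Fin.snoc_last,
    Matrix.sub_apply, mul_add, Finset.sum_add_distrib, Finset.mul_sum]
  have h₁ : ∑ i : Fin N₀, ∑ t : Fin T₀,
        ω i * ((Lhat i.castSucc t.castSucc - Y i.castSucc t.castSucc) * θ t)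
      = -∑ i : Fin N₀, ∑ t : Fin T₀,
        ω i * θ t * (Y i.castSucc t.castSucc - Lhat i.castSucc t.castSucc) := by
    simp only [← Finset.sum_neg_distrib]
    exact Finset.sum_congr rfl fun i _ => Finset.sum_congr rfl fun t _ => by ring
  have h₂ : ∑ i : Fin N₀, ω i * ((Lhat i.castSucc (Fin.last T₀) - Y i.castSucc (Fin.last T₀)) * -1)
      = ∑ i : Fin N₀, ω i * (Y i.castSucc (Fin.last T₀) - Lhat i.castSucc (Fin.last T₀)) :=
    Finset.sum_congr rfl fun i _ => by ring
  have h₃ : ∑ t : Fin T₀,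
        -1 * ((Lhat (Fin.last N₀) t.castSucc - Y (Fin.last N₀) t.castSucc) * θ t)
      = ∑ t : Fin T₀, θ t * (Y (Fin.last N₀) t.castSucc - Lhat (Fin.last N₀) t.castSucc) :=
    Finset.sum_congr rfl fun t _ => by ring
  rw [h₁, h₂, h₃]
  ring

theorem unitDisc_eq_vecMul {N₀ K : ℕ} (ω : Fin N₀ → ℝ) (Γ : Matrix (Fin (N₀ + 1)) (Fin K) ℝ) :
    unitDisc ω Γ = (Fin.snoc ω (-1) : Fin (N₀ + 1) → ℝ) ᵥ* Γ := by
  ext k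
  simp [unitDisc, vecMul, dotProduct, Fin.sum_univ_castSucc, sub_eq_add_neg]

theorem timeDisc_eq_vecMul {T₀ K : ℕ} (θ : Fin T₀ → ℝ) (Λ : Matrix (Fin (T₀ + 1)) (Fin K) ℝ) :
    timeDisc θ Λ = (Fin.snoc θ (-1) : Fin (T₀ + 1) → ℝ) ᵥ* Λ :=
  unitDisc_eq_vecMul θ Λ

theorem integral_dotProduct_mulVec {Ω m n : Type*} [Fintype m] [Fintype n] [MeasurableSpace Ω]
    {μ : Measure Ω} (u : m → ℝ) (v : n → ℝ) {D : Ω → Matrix m n ℝ} {M : Matrix m n ℝ}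
    (hD : ∀ i j, Integrable (fun w => D w i j) μ) (hM : ∀ i j, ∫ w, D w i j ∂μ = M i j) :
    ∫ w, u ⬝ᵥ D w *ᵥ v ∂μ = u ⬝ᵥ M *ᵥ v := by
  simp only [dotProduct, mulVec]
  rw [integral_finsetSum _ fun i _ =>
    (integrable_finsetSum _ fun j _ => (hD i j).mul_const _).const_mul _]
  refine Finset.sum_congr rfl fun i _ => ?_
  rw [integral_const_mul, integral_finsetSum _ fun j _ => (hD i j).mul_const _]
  simp only [integral_mul_const, hM]

theorem abs_dotProduct_mulVec_le {m n : ℕ} (A : Matrix (Fin m) (Fin n) ℝ)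
    (x : Fin m → ℝ) (y : Fin n → ℝ) :
    |x ⬝ᵥ A *ᵥ y| ≤ euclNorm x * euclNorm y * specNorm A := by
  have hinner : x ⬝ᵥ A *ᵥ y
      = inner ℝ (WithLp.toLp 2 x) (Matrix.toEuclideanLin A (WithLp.toLp 2 y)) := by
    simp [EuclideanSpace.inner_eq_star_dotProduct, Matrix.toLpLin_toLp, dotProduct_comm]
  rw [hinner, mul_assoc, mul_comm (euclNorm y)]
  refine (abs_real_inner_le_norm _ _).trans (mul_le_mul_of_nonneg_left ?_ (norm_nonneg _))
  exact (LinearMap.toContinuousLinearMap (Matrix.toEuclideanLin A)).le_opNorm (WithLp.toLp 2 y)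

/-- triple robustness bound: under the factor model `Y = Γ Λᵀ + ε`
with `E[ε_{it}] = 0` and `E[L̂] = Γ (I_K + B) Λᵀ`, for fixed weights `ω, θ`,
`| E[ τ̂_TROP(0;θ,ω) − Y_{NT} ] | ≤ ‖Δ_u(ω,Γ)‖₂ ⬝ ‖Δ_t(θ,Λ)‖₂ ⬝ ‖B‖`. -/
theorem tauTROP_triple_robustness
    {Ω : Type*} [MeasurableSpace Ω] (μ : Measure Ω) [IsProbabilityMeasure μ]
    (N₀ T₀ K : ℕ) (hN : 1 ≤ N₀) (hT : 1 ≤ T₀) (hK : 1 ≤ K)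
    (Γ : Matrix (Fin (N₀ + 1)) (Fin K) ℝ) (Λ : Matrix (Fin (T₀ + 1)) (Fin K) ℝ)
    (B : Matrix (Fin K) (Fin K) ℝ)
    (ε Lhat : Ω → Matrix (Fin (N₀ + 1)) (Fin (T₀ + 1)) ℝ)
    (hεint : ∀ i t, Integrable (fun w => ε w i t) μ)
    (hεmean : ∀ i t, ∫ w, ε w i t ∂μ = 0)
    (hLint : ∀ i t, Integrable (fun w => Lhat w i t) μ)
    (hLmean : ∀ i t, ∫ w, Lhat w i t ∂μ
      = ((Γ * (1 + B) * Λ.transpose : Matrix (Fin (N₀ + 1)) (Fin (T₀ + 1)) ℝ)) i t)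
    (ω : Fin N₀ → ℝ) (θ : Fin T₀ → ℝ) :
    |∫ w, (tauTROP (Γ * Λ.transpose + ε w) (Lhat w) θ ω
        - (Γ * Λ.transpose + ε w) (Fin.last N₀) (Fin.last T₀)) ∂μ|
      ≤ euclNorm (unitDisc ω Γ) * euclNorm (timeDisc θ Λ) * specNorm B := by
  have hbias : ∫ w, (tauTROP (Γ * Λ.transpose + ε w) (Lhat w) θ ω
        - (Γ * Λ.transpose + ε w) (Fin.last N₀) (Fin.last T₀)) ∂μ
      = unitDisc ω Γ ⬝ᵥ B *ᵥ timeDisc θ Λ := by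
    simp only [tauTROP_sub_eq_dotProduct]
    rw [integral_dotProduct_mulVec (D := fun w => Lhat w - (Γ * Λ.transpose + ε w))
      (M := Γ * B * Λ.transpose), unitDisc_eq_vecMul,
      timeDisc_eq_vecMul, ← mulVec_transpose Λ, ← dotProduct_mulVec, mulVec_mulVec, mulVec_mulVec,
      Matrix.mul_assoc]
    · exact fun i t => (hLint i t).sub ((integrable_const _).add (hεint i t))
    · intro i t
      have hY : Integrable (fun w => (Γ * Λ.transpose) i t + ε w i t) μ :=
        (integrable_const _).add (hεint i t)
      simp only [Matrix.sub_apply, Matrix.add_apply]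
      rw [integral_sub (hLint i t) hY, integral_add (integrable_const _) (hεint i t), hεmean,
        hLmean]
      simp [Matrix.mul_add, Matrix.add_mul]
  rw [hbias]
  exact abs_dotProduct_mulVec_le B _ _
end
end

section
/- (Triple robustness corollary.) Let (Ω, F, P) be a probability space and let ε : Ω → ℝ^{N×T} and L̂ : Ω → ℝ^{N×T} be entrywise integrable random matrices with E[ε_{it}] = 0 for every cell (i,t) and with E[L̂] = Γ (I_K + B) Λᵀ entrywise, where Γ ∈ ℝ^{N×K}, Λ ∈ ℝ^{T×K}, B ∈ ℝ^{K×K} and I_K is the K×K identity. Set Y := Γ Λᵀ + ε and fix weights ω ∈ ℝ^{N₀}, θ ∈ ℝ^{T₀}. If any one of the following holds: (1) Σ_{i≤N₀} ω_i Γ_i = Γ_N (balance over unit loadings); or (2) Σ_{s≤T₀} θ_s Λ_s = Λ_T (balance over factor loadings); or (3) B = 0 (correct regression adjustment); then E[ τ̂_TROP(0;θ,ω) − Y_{NT} ] = 0. -/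
open Finset Matrix MeasureTheory

noncomputable section

/-- The weights contrasting the last index with a weighted combination of the other ones. -/
def contrastWeights {n : ℕ} (a : Fin n → ℝ) : Fin (n + 1) → ℝ :=
  Fin.snoc (α := fun _ => ℝ) (-a) 1

lemma contrastWeights_vecMul_eq_zero {n K : ℕ} {a : Fin n → ℝ} {M : Matrix (Fin (n + 1)) (Fin K) ℝ}
    (h : ∀ k, ∑ i : Fin n, a i * M i.castSucc k = M (Fin.last n) k) :
    contrastWeights a ᵥ* M = 0 := by
  ext k
  simp [contrastWeights, vecMul, dotProduct, Fin.sum_univ_castSucc, h k]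

/-- The error of the TROP counterfactual is a bilinear contrast of the residual matrix. -/
lemma tauTROP_sub_eq_sum {N₀ T₀ : ℕ} (Y L : Matrix (Fin (N₀ + 1)) (Fin (T₀ + 1)) ℝ)
    (θ : Fin T₀ → ℝ) (ω : Fin N₀ → ℝ) :
    tauTROP Y L θ ω - Y (Fin.last N₀) (Fin.last T₀) =
      ∑ i, ∑ t, contrastWeights ω i * contrastWeights θ t * (L i t - Y i t) := by
  simp only [tauTROP, contrastWeights, Fin.sum_univ_castSucc, Fin.snoc_castSucc, Fin.snoc_last,
    Pi.neg_apply, Finset.sum_add_distrib, mul_neg, mul_one, one_mul, neg_mul, mul_sub,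
    Finset.sum_sub_distrib, Finset.sum_neg_distrib]
  ring

/-- A bilinear contrast of `Γ * B * Λᵀ` factors through the contrasts of the loadings. -/
lemma sum_mul_mul_apply_eq_dotProduct {m n k : Type*} [Fintype m] [Fintype n] [Fintype k]
    (v : m → ℝ) (u : n → ℝ) (Γ : Matrix m k ℝ) (B : Matrix k k ℝ) (Λ : Matrix n k ℝ) :
    ∑ i, ∑ t, v i * u t * (Γ * B * Λᵀ) i t = (v ᵥ* Γ) ⬝ᵥ (B *ᵥ (u ᵥ* Λ)) := by
  rw [← mulVec_transpose Λ u, dotProduct_mulVec, dotProduct_mulVec, vecMul_vecMul, vecMul_vecMul,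
    ← dotProduct_mulVec, ← Matrix.mul_assoc]
  simp only [dotProduct, mulVec, Finset.mul_sum]
  exact Finset.sum_congr rfl fun i _ => Finset.sum_congr rfl fun t _ => by ring

/-- triple robustness corollary: under the factor model
`Y = Γ Λᵀ + ε` with `E[ε_{it}] = 0` and `E[L̂] = Γ (I_K + B) Λᵀ`, if either
(1) unit loadings are balanced, or (2) factor loadings are balanced, or
(3) `B = 0`, then `E[ τ̂_TROP(0;θ,ω) − Y_{NT} ] = 0`. -/
theorem tauTROP_triple_robustness_corollary
    {Ω : Type*} [MeasurableSpace Ω] (μ : Measure Ω) [IsProbabilityMeasure μ]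
    (N₀ T₀ K : ℕ) (hN : 1 ≤ N₀) (hT : 1 ≤ T₀) (hK : 1 ≤ K)
    (Γ : Matrix (Fin (N₀ + 1)) (Fin K) ℝ) (Λ : Matrix (Fin (T₀ + 1)) (Fin K) ℝ)
    (B : Matrix (Fin K) (Fin K) ℝ)
    (ε Lhat : Ω → Matrix (Fin (N₀ + 1)) (Fin (T₀ + 1)) ℝ)
    (hεint : ∀ i t, Integrable (fun w => ε w i t) μ)
    (hεmean : ∀ i t, ∫ w, ε w i t ∂μ = 0)
    (hLint : ∀ i t, Integrable (fun w => Lhat w i t) μ)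
    (hLmean : ∀ i t, ∫ w, Lhat w i t ∂μ
      = ((Γ * (1 + B) * Λ.transpose : Matrix (Fin (N₀ + 1)) (Fin (T₀ + 1)) ℝ)) i t)
    (ω : Fin N₀ → ℝ) (θ : Fin T₀ → ℝ)
    (hrobust :
      (∀ k, ∑ i : Fin N₀, ω i * Γ i.castSucc k = Γ (Fin.last N₀) k) ∨
      (∀ k, ∑ s : Fin T₀, θ s * Λ s.castSucc k = Λ (Fin.last T₀) k) ∨
      B = 0) :
    ∫ w, (tauTROP (Γ * Λ.transpose + ε w) (Lhat w) θ ω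
        - (Γ * Λ.transpose + ε w) (Fin.last N₀) (Fin.last T₀)) ∂μ = 0 := by
  have hY : ∀ i t, Integrable (fun w => (Γ * Λᵀ + ε w) i t) μ := fun i t =>
    (integrable_const ((Γ * Λᵀ) i t)).add (hεint i t)
  have hmean : ∀ i t, ∫ w, (Lhat w i t - (Γ * Λᵀ + ε w) i t) ∂μ = (Γ * B * Λᵀ) i t := by
    intro i t
    rw [integral_sub (hLint i t) (hY i t), hLmean]
    simp only [Matrix.add_apply]
    rw [integral_add (integrable_const _) (hεint i t), hεmean, integral_const]
    simp [Matrix.mul_add, Matrix.add_mul]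
  have hint : ∀ i t, Integrable (fun w => contrastWeights ω i * contrastWeights θ t *
      (Lhat w i t - (Γ * Λᵀ + ε w) i t)) μ :=
    fun i t => ((hLint i t).sub (hY i t)).const_mul _
  simp_rw [tauTROP_sub_eq_sum]
  rw [integral_finsetSum _ fun i _ => integrable_finsetSum _ fun t _ => hint i t]
  simp_rw [integral_finsetSum _ fun t _ => hint _ t, integral_const_mul, hmean]
  rw [sum_mul_mul_apply_eq_dotProduct]
  rcases hrobust with h | h | rfl
  · simp [contrastWeights_vecMul_eq_zero h]
  · simp [contrastWeights_vecMul_eq_zero h]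
  · simp
end
end

section
/- Let (Ω, F, P) be a probability space, L ∈ ℝ^{N×T} a deterministic matrix, and let ε : Ω → ℝ^{N×T} and L̂ : Ω → ℝ^{N×T} be entrywise integrable random matrices with E[ε_{it}] = 0 for every cell (i,t). Set Y := L + ε. Then for fixed weights ω ∈ ℝ^{N₀} and θ ∈ ℝ^{T₀}, E[ τ̂_TROP(0;θ,ω) − Y_{NT} ] = ⟨ L − E[L̂] , M(θ,ω) ⟩. -/
open Finset Matrix MeasureTheory

noncomputable section

/-- Frobenius inner product of two `N × T` real matrices. -/
def frobInner {N T : ℕ} (A B : Matrix (Fin N) (Fin T) ℝ) : ℝ :=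
  ∑ i, ∑ t, A i t * B i t

/-- The rank-one matrix `M(θ,ω) = (e_N − U_ω)(V_θ − e_T)ᵀ`. -/
def Mmat {N₀ T₀ : ℕ} (θ : Fin T₀ → ℝ) (ω : Fin N₀ → ℝ) :
    Matrix (Fin (N₀ + 1)) (Fin (T₀ + 1)) ℝ :=
  Matrix.of fun i t =>
    ((if i = Fin.last N₀ then (1 : ℝ) else 0) - (Fin.snoc ω (0 : ℝ) : Fin (N₀ + 1) → ℝ) i) *
      ((Fin.snoc θ (0 : ℝ) : Fin (T₀ + 1) → ℝ) t - (if t = Fin.last T₀ then (1 : ℝ) else 0))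

/-- The estimation error is the Frobenius pairing of the residual matrix with `M(θ,ω)`. -/
theorem tauTROP_sub_eq_frobInner {N₀ T₀ : ℕ}
    (Y Lhat : Matrix (Fin (N₀ + 1)) (Fin (T₀ + 1)) ℝ) (θ : Fin T₀ → ℝ) (ω : Fin N₀ → ℝ) :
    tauTROP Y Lhat θ ω - Y (Fin.last N₀) (Fin.last T₀) = frobInner (Y - Lhat) (Mmat θ ω) := by
  simp only [tauTROP, frobInner, Mmat, Fin.sum_univ_castSucc, Matrix.sub_apply, Matrix.of_apply,
    Fin.snoc_castSucc, Fin.snoc_last, Fin.castSucc_ne_last, if_true, if_false, sub_zero, zero_sub,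
    one_mul, mul_neg, mul_one, neg_mul, Finset.sum_add_distrib, Finset.sum_neg_distrib,
    mul_comm (Y _ _ - Lhat _ _)]
  ring

/-- Expectation commutes with the Frobenius pairing against a fixed matrix. -/
theorem integral_frobInner {Ω : Type*} [MeasurableSpace Ω] {μ : Measure Ω} {N T : ℕ}
    {A : Ω → Matrix (Fin N) (Fin T) ℝ} (hA : ∀ i t, Integrable (fun w => A w i t) μ)
    (B : Matrix (Fin N) (Fin T) ℝ) :
    ∫ w, frobInner (A w) B ∂μ = frobInner (Matrix.of fun i t => ∫ w, A w i t ∂μ) B := by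
  simp only [frobInner, Matrix.of_apply]
  rw [integral_finsetSum _ fun i _ => integrable_finsetSum _ fun t _ => (hA i t).mul_const (B i t)]
  refine Finset.sum_congr rfl fun i _ => ?_
  rw [integral_finsetSum _ fun t _ => (hA i t).mul_const (B i t)]
  exact Finset.sum_congr rfl fun t _ => integral_mul_const _ _

/-- with `Y = L + ε`, `E[ε_{it}] = 0`, and fixed weights `ω, θ`,
`E[ τ̂_TROP(0;θ,ω) − Y_{NT} ] = ⟨ L − E[L̂] , M(θ,ω) ⟩`. -/
theorem tauTROP_conditional_bias
    {Ω : Type*} [MeasurableSpace Ω] (μ : Measure Ω) [IsProbabilityMeasure μ]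
    (N₀ T₀ : ℕ) (hN : 1 ≤ N₀) (hT : 1 ≤ T₀)
    (L : Matrix (Fin (N₀ + 1)) (Fin (T₀ + 1)) ℝ)
    (ε Lhat : Ω → Matrix (Fin (N₀ + 1)) (Fin (T₀ + 1)) ℝ)
    (hεint : ∀ i t, Integrable (fun w => ε w i t) μ)
    (hεmean : ∀ i t, ∫ w, ε w i t ∂μ = 0)
    (hLint : ∀ i t, Integrable (fun w => Lhat w i t) μ)
    (ω : Fin N₀ → ℝ) (θ : Fin T₀ → ℝ) :
    ∫ w, (tauTROP (L + ε w) (Lhat w) θ ω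
        - (L + ε w) (Fin.last N₀) (Fin.last T₀)) ∂μ
      = frobInner (L - Matrix.of fun i t => ∫ w, Lhat w i t ∂μ) (Mmat θ ω) := by
  simp only [tauTROP_sub_eq_frobInner]
  have hY : ∀ i t, Integrable (fun w => (L + ε w) i t) μ := fun i t =>
    (integrable_const (L i t)).add (hεint i t)
  rw [integral_frobInner (A := fun w => L + ε w - Lhat w)
    (fun i t => (hY i t).sub (hLint i t))]
  congr 1
  ext i t
  simp only [Matrix.sub_apply, Matrix.of_apply]
  rw [integral_sub (hY i t) (hLint i t)]
  simp only [Matrix.add_apply]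
  rw [integral_add (integrable_const _) (hεint i t), hεmean i t]
  simp
end
end

section
/- (Bias of difference-in-differences under a factor model.) Let (Ω, F, P) be a probability space, Γ ∈ ℝ^{N×K}, Λ ∈ ℝ^{T×K}, and ε : Ω → ℝ^{N×T} an entrywise integrable random matrix with E[ε_{it}] = 0 for every cell (i,t). Set Y := Γ Λᵀ + ε and define the difference-in-differences contrast τ̂^{DID} := Y_{NT} − (1/T₀) Σ_{t≤T₀} Y_{Nt} − (1/N₀) Σ_{i≤N₀} Y_{iT} + (1/(N₀ T₀)) Σ_{i≤N₀} Σ_{t≤T₀} Y_{it}. Then E[ τ̂^{DID} ] = (Γ_N − Γ̄₀)ᵀ (Λ_T − Λ̄₀), where Γ̄₀ := (1/N₀) Σ_{i≤N₀} Γ_i and Λ̄₀ := (1/T₀) Σ_{t≤T₀} Λ_t. -/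
open Finset Matrix MeasureTheory

noncomputable section

/-- bias of difference-in-differences under a factor model:
with `Y = Γ Λᵀ + ε` and `E[ε_{it}] = 0`,
`E[ τ̂^DID ] = (Γ_N − Γ̄₀)ᵀ (Λ_T − Λ̄₀)` where `Γ̄₀, Λ̄₀` are the control averages. -/
theorem did_bias_factor_model
    {Ω : Type*} [MeasurableSpace Ω] (μ : Measure Ω) [IsProbabilityMeasure μ]
    (N₀ T₀ K : ℕ) (hN : 1 ≤ N₀) (hT : 1 ≤ T₀) (hK : 1 ≤ K)
    (Γ : Matrix (Fin (N₀ + 1)) (Fin K) ℝ) (Λ : Matrix (Fin (T₀ + 1)) (Fin K) ℝ)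
    (ε : Ω → Matrix (Fin (N₀ + 1)) (Fin (T₀ + 1)) ℝ)
    (hεint : ∀ i t, Integrable (fun w => ε w i t) μ)
    (hεmean : ∀ i t, ∫ w, ε w i t ∂μ = 0)
    (Y : Ω → Matrix (Fin (N₀ + 1)) (Fin (T₀ + 1)) ℝ)
    (hY : ∀ w, Y w = Γ * Λ.transpose + ε w) :
    (∫ w, (Y w (Fin.last N₀) (Fin.last T₀)
        - (1 / (T₀ : ℝ)) * ∑ t : Fin T₀, Y w (Fin.last N₀) t.castSucc
        - (1 / (N₀ : ℝ)) * ∑ i : Fin N₀, Y w i.castSucc (Fin.last T₀)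
        + (1 / ((N₀ : ℝ) * (T₀ : ℝ))) *
            ∑ i : Fin N₀, ∑ t : Fin T₀, Y w i.castSucc t.castSucc) ∂μ)
      = (fun k => Γ (Fin.last N₀) k - (1 / (N₀ : ℝ)) * ∑ i : Fin N₀, Γ i.castSucc k)
          ⬝ᵥ (fun k => Λ (Fin.last T₀) k - (1 / (T₀ : ℝ)) * ∑ t : Fin T₀, Λ t.castSucc k) := by
  have hYit : ∀ i t w, Y w i t = (∑ k, Γ i k * Λ t k) + ε w i t := fun i t w => by
    simp [hY, Matrix.mul_apply]
  have hint : ∀ i t, Integrable (fun w => Y w i t) μ := fun i t => by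
    simpa only [hYit] using (integrable_const _).fun_add (hεint i t)
  have hmean : ∀ i t, ∫ w, Y w i t ∂μ = ∑ k, Γ i k * Λ t k := fun i t => by
    simp only [hYit]
    rw [integral_add (integrable_const _) (hεint i t), hεmean]
    simp
  have hrow := (integrable_finsetSum univ fun (t : Fin T₀) _ =>
    hint (Fin.last N₀) t.castSucc).const_mul (1 / (T₀ : ℝ))
  have hcol := (integrable_finsetSum univ fun (i : Fin N₀) _ =>
    hint i.castSucc (Fin.last T₀)).const_mul (1 / (N₀ : ℝ))
  have hinner : ∀ i : Fin N₀,
      Integrable (fun w => ∑ t : Fin T₀, Y w i.castSucc t.castSucc) μ := fun i =>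
    integrable_finsetSum univ fun t _ => hint i.castSucc t.castSucc
  have hblock := (integrable_finsetSum univ fun (i : Fin N₀) _ =>
    hinner i).const_mul (1 / ((N₀ : ℝ) * (T₀ : ℝ)))
  have hlast := hint (Fin.last N₀) (Fin.last T₀)
  have hlast_row : Integrable (fun w => Y w (Fin.last N₀) (Fin.last T₀)
      - (1 / (T₀ : ℝ)) * ∑ t : Fin T₀, Y w (Fin.last N₀) t.castSucc) μ := hlast.sub hrow
  have hlast_row_col : Integrable (fun w => Y w (Fin.last N₀) (Fin.last T₀)
      - (1 / (T₀ : ℝ)) * ∑ t : Fin T₀, Y w (Fin.last N₀) t.castSucc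
      - (1 / (N₀ : ℝ)) * ∑ i : Fin N₀, Y w i.castSucc (Fin.last T₀)) μ := hlast_row.sub hcol
  rw [integral_add hlast_row_col hblock, integral_sub hlast_row hcol, integral_sub hlast hrow,
    integral_const_mul, integral_const_mul, integral_const_mul,
    integral_finsetSum _ fun t _ => hint _ _, integral_finsetSum _ fun i _ => hint _ _,
    integral_finsetSum _ fun i _ => hinner i]
  simp only [integral_finsetSum _ fun (t : Fin T₀) _ => hint _ t.castSucc, hmean]
  have hswap : ∑ i : Fin N₀, ∑ t : Fin T₀, ∑ k, Γ i.castSucc k * Λ t.castSucc k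
      = ∑ k, (∑ i : Fin N₀, Γ i.castSucc k) * ∑ t : Fin T₀, Λ t.castSucc k := by
    simp only [Finset.sum_mul_sum]
    rw [Finset.sum_comm]
    simp only [Finset.sum_comm (s := (univ : Finset (Fin K)))]
    exact Finset.sum_comm
  rw [hswap, Finset.sum_comm (s := (univ : Finset (Fin T₀))),
    Finset.sum_comm (s := (univ : Finset (Fin N₀)))]
  simp only [← Finset.mul_sum, ← Finset.sum_mul, dotProduct]
  simp only [Finset.mul_sum (s := (univ : Finset (Fin K))), ← Finset.sum_sub_distrib,
    ← Finset.sum_add_distrib]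
  refine Finset.sum_congr rfl fun k _ => ?_
  ring
end
end

section
/- (Bias of synthetic difference-in-differences under a factor model.) Let (Ω, F, P) be a probability space, Γ ∈ ℝ^{N×K}, Λ ∈ ℝ^{T×K}, and ε : Ω → ℝ^{N×T} an entrywise integrable random matrix with E[ε_{it}] = 0 for every cell (i,t). Set Y := Γ Λᵀ + ε and, for weights ω ∈ ℝ^{N₀} and θ ∈ ℝ^{T₀}, define τ̂^{SDID} := Y_{NT} − ( Σ_{t≤T₀} θ_t Y_{Nt} + Σ_{i≤N₀} ω_i Y_{iT} − Σ_{i≤N₀} Σ_{t≤T₀} ω_i θ_t Y_{it} ). Then E[ τ̂^{SDID} ] = ( Γ̄₀(ω) − Γ_N )ᵀ ( Λ̄₀(θ) − Λ_T ), where Γ̄₀(ω) := Σ_{i≤N₀} ω_i Γ_i and Λ̄₀(θ) := Σ_{t≤T₀} θ_t Λ_t. -/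
open Finset Matrix MeasureTheory

noncomputable section

/-- The synthetic difference-in-differences contrast is the bilinear form with left weights
`(-ω, 1)` and right weights `(-θ, 1)`. -/
theorem sdid_contrast_eq_sum {n m : ℕ} (M : Matrix (Fin (n + 1)) (Fin (m + 1)) ℝ)
    (ω : Fin n → ℝ) (θ : Fin m → ℝ) :
    M (Fin.last n) (Fin.last m)
        - ((∑ t : Fin m, θ t * M (Fin.last n) t.castSucc)
          + (∑ i : Fin n, ω i * M i.castSucc (Fin.last m))
          - ∑ i : Fin n, ∑ t : Fin m, ω i * θ t * M i.castSucc t.castSucc)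
      = ∑ i, ∑ t, Fin.snoc (α := fun _ => ℝ) (-ω) 1 i
          * Fin.snoc (α := fun _ => ℝ) (-θ) 1 t * M i t := by
  simp only [Fin.sum_univ_castSucc, Fin.snoc_castSucc, Fin.snoc_last, Pi.neg_apply,
    Finset.sum_add_distrib, neg_mul, one_mul, mul_one, mul_neg,
    Finset.sum_neg_distrib]
  ring

/-- A bilinear form evaluated at `Γ * Λᵀ` is the dot product of the weighted row sums. -/
theorem sum_mul_mul_transpose_eq_dotProduct {I J L : Type*} [Fintype I] [Fintype J] [Fintype L]
    (Γ : Matrix I L ℝ) (Λ : Matrix J L ℝ) (a : I → ℝ) (b : J → ℝ) :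
    ∑ i, ∑ t, a i * b t * (Γ * Λ.transpose) i t = (a ᵥ* Γ) ⬝ᵥ (b ᵥ* Λ) := by
  rw [← Matrix.mulVec_transpose Λ b, Matrix.dotProduct_mulVec, Matrix.vecMul_vecMul,
    ← Matrix.dotProduct_mulVec]
  simp only [dotProduct, mulVec, Finset.mul_sum]
  exact Finset.sum_congr rfl fun i _ => Finset.sum_congr rfl fun t _ => by ring

/-- Weighting the rows of `A` by `(-ω, 1)`. -/
theorem snoc_neg_one_vecMul {n : ℕ} {L : Type*} (A : Matrix (Fin (n + 1)) L ℝ) (ω : Fin n → ℝ) :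
    Fin.snoc (α := fun _ => ℝ) (-ω) 1 ᵥ* A
      = -fun k => (∑ i : Fin n, ω i * A i.castSucc k) - A (Fin.last n) k := by
  ext k
  simp [vecMul, dotProduct, Fin.sum_univ_castSucc]
  ring

/-- bias of synthetic difference-in-differences under a factor model:
with `Y = Γ Λᵀ + ε` and `E[ε_{it}] = 0`, for weights `ω, θ`,
`E[ τ̂^SDID ] = ( Γ̄₀(ω) − Γ_N )ᵀ ( Λ̄₀(θ) − Λ_T )`. -/
theorem sdid_bias_factor_model
    {Ω : Type*} [MeasurableSpace Ω] (μ : Measure Ω) [IsProbabilityMeasure μ]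
    (N₀ T₀ K : ℕ) (hN : 1 ≤ N₀) (hT : 1 ≤ T₀) (hK : 1 ≤ K)
    (Γ : Matrix (Fin (N₀ + 1)) (Fin K) ℝ) (Λ : Matrix (Fin (T₀ + 1)) (Fin K) ℝ)
    (ε : Ω → Matrix (Fin (N₀ + 1)) (Fin (T₀ + 1)) ℝ)
    (hεint : ∀ i t, Integrable (fun w => ε w i t) μ)
    (hεmean : ∀ i t, ∫ w, ε w i t ∂μ = 0)
    (Y : Ω → Matrix (Fin (N₀ + 1)) (Fin (T₀ + 1)) ℝ)
    (hY : ∀ w, Y w = Γ * Λ.transpose + ε w)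
    (ω : Fin N₀ → ℝ) (θ : Fin T₀ → ℝ) :
    (∫ w, (Y w (Fin.last N₀) (Fin.last T₀)
        - ((∑ t : Fin T₀, θ t * Y w (Fin.last N₀) t.castSucc)
          + (∑ i : Fin N₀, ω i * Y w i.castSucc (Fin.last T₀))
          - ∑ i : Fin N₀, ∑ t : Fin T₀, ω i * θ t * Y w i.castSucc t.castSucc)) ∂μ)
      = (fun k => (∑ i : Fin N₀, ω i * Γ i.castSucc k) - Γ (Fin.last N₀) k)
          ⬝ᵥ (fun k => (∑ t : Fin T₀, θ t * Λ t.castSucc k) - Λ (Fin.last T₀) k) := by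
  have hYint : ∀ i t, Integrable (fun w => Y w i t) μ := fun i t => by
    simp only [hY, Matrix.add_apply]
    exact (integrable_const _).add (hεint i t)
  have hYmean : ∀ i t, ∫ w, Y w i t ∂μ = (Γ * Λ.transpose) i t := fun i t => by
    simp only [hY, Matrix.add_apply]
    rw [integral_add (integrable_const _) (hεint i t), hεmean]
    simp
  simp only [sdid_contrast_eq_sum]
  rw [integral_finsetSum _ fun i _ => integrable_finsetSum _ fun t _ => (hYint i t).const_mul _]
  simp only [integral_finsetSum _ fun t _ => (hYint _ t).const_mul _, integral_const_mul, hYmean]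
  rw [sum_mul_mul_transpose_eq_dotProduct, snoc_neg_one_vecMul, snoc_neg_one_vecMul,
    neg_dotProduct_neg]
end
end

section
/- (Bias bound with covariates.) Under the setup of the covariate bias decomposition — namely: X_{it} ∈ ℝ^p for each cell (i,t), β, δ ∈ ℝ^p, Γ ∈ ℝ^{N×K}, Λ ∈ ℝ^{T×K}, B ∈ ℝ^{K×K}, E_⊥ ∈ ℝ^{N×T}, entrywise integrable random matrices ε, L̂ with E[ε_{it}] = 0 for every (i,t) and E[L̂] − L = Xδ + Γ B Λᵀ + E_⊥ entrywise, where L_{it} := X_{it}ᵀβ + (ΓΛᵀ)_{it} and Y := L + ε — if in addition ω ≥ 0 entrywise, θ ≥ 0 entrywise, Σ_{i≤N₀} ω_i = 1 and Σ_{t≤T₀} θ_t = 1, then | E[ τ̂_TROP(0;θ,ω) − Y_{NT} ] | ≤ ‖Δ_u(ω,Γ)‖₂ · ‖B‖ · ‖Δ_t(θ,Λ)‖₂ + ‖g(θ,ω)‖₂ · ‖δ‖₂ + 4 ‖E_⊥‖_max, where ‖B‖ is the spectral norm of B, g(θ,ω) := Σ_{i,t} M(θ,ω)_{it} X_{it}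 and ‖E_⊥‖_max := max_{i,t} |(E_⊥)_{it}|. -/
open Finset Matrix MeasureTheory

noncomputable section

/-- Max (entrywise sup) norm of a matrix: `‖E‖_max = max_{i,t} |E_{it}|`. -/
def maxNorm {N T : ℕ} (E : Matrix (Fin (N + 1)) (Fin (T + 1)) ℝ) : ℝ :=
  ⨆ i, ⨆ t, |E i t|

theorem tauTROP_sub_eq_sum_Mmat {N₀ T₀ : ℕ} (Y Lhat : Matrix (Fin (N₀ + 1)) (Fin (T₀ + 1)) ℝ)
    (θ : Fin T₀ → ℝ) (ω : Fin N₀ → ℝ) :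
    tauTROP Y Lhat θ ω - Y (Fin.last N₀) (Fin.last T₀)
      = ∑ i, ∑ t, Mmat θ ω i t * (Y i t - Lhat i t) := by
  simp only [tauTROP, Mmat, Matrix.of_apply, Fin.sum_univ_castSucc, Fin.snoc_castSucc,
    Fin.snoc_last, if_true, Fin.castSucc_ne_last, if_false, zero_sub, sub_zero, one_mul,
    Finset.sum_add_distrib, neg_mul, mul_neg, mul_one, Finset.sum_neg_distrib]
  ring

theorem euclNorm_nonneg {n : ℕ} (v : Fin n → ℝ) : 0 ≤ euclNorm v :=
  norm_nonneg _

theorem abs_dotProduct_le_euclNorm {n : ℕ} (v w : Fin n → ℝ) :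
    |v ⬝ᵥ w| ≤ euclNorm v * euclNorm w := by
  have h := abs_real_inner_le_norm (WithLp.toLp 2 w) (WithLp.toLp 2 v)
  rw [EuclideanSpace.inner_toLp_toLp] at h
  simpa [euclNorm, mul_comm] using h

theorem euclNorm_mulVec_le {m n : ℕ} (A : Matrix (Fin m) (Fin n) ℝ) (v : Fin n → ℝ) :
    euclNorm (A *ᵥ v) ≤ specNorm A * euclNorm v :=
  (LinearMap.toContinuousLinearMap (Matrix.toEuclideanLin A)).le_opNorm (WithLp.toLp 2 v)

theorem abs_le_maxNorm {N T : ℕ} (E : Matrix (Fin (N + 1)) (Fin (T + 1)) ℝ)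
    (i : Fin (N + 1)) (t : Fin (T + 1)) : |E i t| ≤ maxNorm E :=
  (le_ciSup (f := fun t => |E i t|) (Set.finite_range _).bddAbove t).trans
    (le_ciSup (f := fun i => ⨆ t, |E i t|) (Set.finite_range _).bddAbove i)

theorem sum_Mmat_mul_factor {N₀ T₀ K : ℕ} (θ : Fin T₀ → ℝ) (ω : Fin N₀ → ℝ)
    (Γ : Matrix (Fin (N₀ + 1)) (Fin K) ℝ) (Λ : Matrix (Fin (T₀ + 1)) (Fin K) ℝ)
    (B : Matrix (Fin K) (Fin K) ℝ) :
    ∑ i, ∑ t, Mmat θ ω i t * (Γ * B * Λ.transpose) i t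
      = -(unitDisc ω Γ ⬝ᵥ (B *ᵥ timeDisc θ Λ)) := by
  set u : Fin (N₀ + 1) → ℝ := fun i =>
    (if i = Fin.last N₀ then (1 : ℝ) else 0) - (Fin.snoc ω (0 : ℝ) : Fin (N₀ + 1) → ℝ) i with hu
  set v : Fin (T₀ + 1) → ℝ := fun t =>
    (Fin.snoc θ (0 : ℝ) : Fin (T₀ + 1) → ℝ) t - (if t = Fin.last T₀ then (1 : ℝ) else 0) with hv
  have h_unit : u ᵥ* Γ = -unitDisc ω Γ := by
    ext k
    simp [hu, Matrix.vecMul, dotProduct, unitDisc, Fin.sum_univ_castSucc, Fin.castSucc_ne_last]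
    ring
  have h_time : v ᵥ* Λ = timeDisc θ Λ := by
    ext k
    simp [hv, Matrix.vecMul, dotProduct, timeDisc, Fin.sum_univ_castSucc, Fin.castSucc_ne_last]
    ring
  calc ∑ i, ∑ t, Mmat θ ω i t * (Γ * B * Λ.transpose) i t
      = u ⬝ᵥ ((Γ * B * Λ.transpose) *ᵥ v) := by
        simp only [dotProduct, Matrix.mulVec, Finset.mul_sum]
        refine Finset.sum_congr rfl fun i _ => Finset.sum_congr rfl fun t _ => ?_
        simp only [Mmat, Matrix.of_apply, hu, hv]
        ring
    _ = -(unitDisc ω Γ ⬝ᵥ (B *ᵥ timeDisc θ Λ)) := by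
        rw [← Matrix.mulVec_mulVec, ← Matrix.mulVec_mulVec, Matrix.mulVec_transpose,
          Matrix.dotProduct_mulVec, h_unit, h_time, neg_dotProduct]

theorem sum_abs_Mmat {N₀ T₀ : ℕ} {θ : Fin T₀ → ℝ} {ω : Fin N₀ → ℝ}
    (hω : ∀ i, 0 ≤ ω i) (hθ : ∀ t, 0 ≤ θ t)
    (hωsum : ∑ i, ω i = 1) (hθsum : ∑ t, θ t = 1) :
    ∑ i, ∑ t, |Mmat θ ω i t| = 4 := by
  simp only [Mmat, Matrix.of_apply, abs_mul, ← Finset.mul_sum, ← Finset.sum_mul]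
  simp [Fin.sum_univ_castSucc, Fin.castSucc_ne_last, abs_of_nonneg (hω _),
    abs_of_nonneg (hθ _), hωsum, hθsum]
  norm_num

theorem abs_sum_Mmat_mul_le {N₀ T₀ : ℕ} {θ : Fin T₀ → ℝ} {ω : Fin N₀ → ℝ}
    (hω : ∀ i, 0 ≤ ω i) (hθ : ∀ t, 0 ≤ θ t)
    (hωsum : ∑ i, ω i = 1) (hθsum : ∑ t, θ t = 1)
    (E : Matrix (Fin (N₀ + 1)) (Fin (T₀ + 1)) ℝ) :
    |∑ i, ∑ t, Mmat θ ω i t * E i t| ≤ 4 * maxNorm E := by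
  rw [← sum_abs_Mmat hω hθ hωsum hθsum, Finset.sum_mul]
  refine (Finset.abs_sum_le_sum_abs _ _).trans (Finset.sum_le_sum fun i _ => ?_)
  rw [Finset.sum_mul]
  refine (Finset.abs_sum_le_sum_abs _ _).trans (Finset.sum_le_sum fun t _ => ?_)
  rw [abs_mul]
  exact mul_le_mul_of_nonneg_left (abs_le_maxNorm E i t) (abs_nonneg _)

theorem sum_mul_dotProduct {m n p : ℕ} (M : Matrix (Fin m) (Fin n) ℝ)
    (X : Fin m → Fin n → Fin p → ℝ) (δ : Fin p → ℝ) :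
    ∑ i, ∑ t, M i t * (X i t ⬝ᵥ δ) = (fun k => ∑ i, ∑ t, M i t * X i t k) ⬝ᵥ δ := by
  have h : (fun k => ∑ i, ∑ t, M i t * X i t k) = ∑ i, ∑ t, M i t • X i t := by
    ext k
    simp
  simp only [h, sum_dotProduct, smul_dotProduct, smul_eq_mul]

/-- bias bound with covariates: under the covariate bias
decomposition setup, if moreover `ω ≥ 0`, `θ ≥ 0` and both sum to one, then
`| E[ τ̂_TROP(0;θ,ω) − Y_{NT} ] | ≤ ‖Δ_u‖₂ ‖B‖ ‖Δ_t‖₂ + ‖g(θ,ω)‖₂ ‖δ‖₂ + 4 ‖E_⊥‖_max`. -/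
theorem tauTROP_bias_bound_with_covariates
    {Ω : Type*} [MeasurableSpace Ω] (μ : Measure Ω) [IsProbabilityMeasure μ]
    (N₀ T₀ K p : ℕ) (hN : 1 ≤ N₀) (hT : 1 ≤ T₀) (hK : 1 ≤ K) (hp : 1 ≤ p)
    (X : Fin (N₀ + 1) → Fin (T₀ + 1) → Fin p → ℝ) (β δ : Fin p → ℝ)
    (Γ : Matrix (Fin (N₀ + 1)) (Fin K) ℝ) (Λ : Matrix (Fin (T₀ + 1)) (Fin K) ℝ)
    (B : Matrix (Fin K) (Fin K) ℝ)
    (Eperp : Matrix (Fin (N₀ + 1)) (Fin (T₀ + 1)) ℝ)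
    (ε Lhat : Ω → Matrix (Fin (N₀ + 1)) (Fin (T₀ + 1)) ℝ)
    (hεint : ∀ i t, Integrable (fun w => ε w i t) μ)
    (hεmean : ∀ i t, ∫ w, ε w i t ∂μ = 0)
    (hLint : ∀ i t, Integrable (fun w => Lhat w i t) μ)
    (L : Matrix (Fin (N₀ + 1)) (Fin (T₀ + 1)) ℝ)
    (hL : ∀ i t, L i t = X i t ⬝ᵥ β
      + ((Γ * Λ.transpose : Matrix (Fin (N₀ + 1)) (Fin (T₀ + 1)) ℝ)) i t)
    (hLhatMean : ∀ i t, (∫ w, Lhat w i t ∂μ) - L i t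
      = X i t ⬝ᵥ δ
        + ((Γ * B * Λ.transpose : Matrix (Fin (N₀ + 1)) (Fin (T₀ + 1)) ℝ)) i t
        + Eperp i t)
    (ω : Fin N₀ → ℝ) (θ : Fin T₀ → ℝ)
    (hω : ∀ i, 0 ≤ ω i) (hθ : ∀ t, 0 ≤ θ t)
    (hωsum : ∑ i, ω i = 1) (hθsum : ∑ t, θ t = 1) :
    |∫ w, (tauTROP (L + ε w) (Lhat w) θ ω
        - (L + ε w) (Fin.last N₀) (Fin.last T₀)) ∂μ|
      ≤ euclNorm (unitDisc ω Γ) * specNorm B * euclNorm (timeDisc θ Λ)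
        + euclNorm (fun k => ∑ i, ∑ t, Mmat θ ω i t * X i t k) * euclNorm δ
        + 4 * maxNorm Eperp := by
  have h_int : ∀ i t, Integrable
      (fun w => Mmat θ ω i t * ((L + ε w) i t - Lhat w i t)) μ := fun i t =>
    (((integrable_const (L i t)).add (hεint i t)).sub (hLint i t)).const_mul _
  have h_mean : ∀ i t, ∫ w, Mmat θ ω i t * ((L + ε w) i t - Lhat w i t) ∂μ
      = -(Mmat θ ω i t * (X i t ⬝ᵥ δ) + Mmat θ ω i t * (Γ * B * Λ.transpose) i t
        + Mmat θ ω i t * Eperp i t) := by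
    intro i t
    have h_const : Integrable (fun _ => L i t) μ := integrable_const _
    have h_add : Integrable (fun w => L i t + ε w i t) μ := h_const.add (hεint i t)
    simp only [Matrix.add_apply]
    rw [integral_const_mul, integral_sub h_add (hLint i t),
      integral_add h_const (hεint i t), hεmean, integral_const]
    simp only [probReal_univ, one_smul]
    linear_combination (-Mmat θ ω i t) * hLhatMean i t
  simp only [tauTROP_sub_eq_sum_Mmat]
  rw [integral_finsetSum _ fun i _ => integrable_finsetSum _ fun t _ => h_int i t]
  simp_rw [integral_finsetSum _ fun t _ => h_int _ t, h_mean, Finset.sum_neg_distrib,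
    Finset.sum_add_distrib]
  rw [sum_mul_dotProduct, sum_Mmat_mul_factor, abs_neg]
  have h_factor : |-(unitDisc ω Γ ⬝ᵥ (B *ᵥ timeDisc θ Λ))|
      ≤ euclNorm (unitDisc ω Γ) * specNorm B * euclNorm (timeDisc θ Λ) := by
    rw [abs_neg, mul_assoc]
    exact (abs_dotProduct_le_euclNorm _ _).trans
      (mul_le_mul_of_nonneg_left (euclNorm_mulVec_le B _) (euclNorm_nonneg _))
  have h_cov := abs_dotProduct_le_euclNorm (fun k => ∑ i, ∑ t, Mmat θ ω i t * X i t k) δ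
  have h_perp := abs_sum_Mmat_mul_le hω hθ hωsum hθsum Eperp
  refine (abs_add_three _ _ _).trans ?_
  linarith
end
end
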